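/- arXiv:0806.4958 — 2 statements merged into one kernel-verified Lean document; each statement's English description precedes it below -/
import Mathlib

section
/- Let β ∈ (0,1/2) be irrational with continued fraction expansion [0; a₁, a₂, …], convergents A_k/B_k, and D_k = B_kβ − A_k. Let m be a positive integer with Ostrowski representation m = Σ_{j=0}^{p} c_{j+1} B_j of type γ(m) = 0 (so c₁ ≥ 1). Then ‖mβ‖ ≥ min( (c₁ − 1)|D₀| + (a₂ − c₂)|D₁| , (a₁ − c₁)|D₀| + c₂|D₁| ), and consequently ‖mβ‖ ≥ min( (c₁ − 1)/(2B₁) + (a₂ − c₂)/(2B₂) , (a₁ − c₁)/(2B₁) + c₂/(2B₂) ). -/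
/-- `‖x‖`, the distance from `x` to the nearest integer: `min_{A ∈ ℤ} |x - A|`. -/
noncomputable def nearestIntDist (x : ℝ) : ℝ := |x - round x|

/-- The Gauss-map iterates of `β`: `x_0 = β`, `x_{k+1} = 1/x_k - ⌊1/x_k⌋`. -/
noncomputable def gaussIter (β : ℝ) : ℕ → ℝ
  | 0 => β
  | k + 1 => 1 / gaussIter β k - ⌊1 / gaussIter β k⌋

/-- The `k`-th partial quotient (`k ≥ 1`) of the continued fraction `β = [0; a₁, a₂, …]`. -/
noncomputable def pq (β : ℝ) (k : ℕ) : ℤ := ⌊1 / gaussIter β (k - 1)⌋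

/-- The continued fraction denominators: `B₀ = 1`, `B₁ = a₁`,
`B_{k+2} = a_{k+2} B_{k+1} + B_k`. -/
noncomputable def cfB (β : ℝ) : ℕ → ℤ
  | 0 => 1
  | 1 => pq β 1
  | (k + 2) => pq β (k + 2) * cfB β (k + 1) + cfB β k

/-- The continued fraction numerators: `A₀ = 0`, `A₁ = 1`,
`A_{k+2} = a_{k+2} A_{k+1} + A_k`. -/
noncomputable def cfA (β : ℝ) : ℕ → ℤ
  | 0 => 0
  | 1 => 1
  | (k + 2) => pq β (k + 2) * cfA β (k + 1) + cfA β k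

/-- `D_k = B_k β - A_k`. -/
noncomputable def cfD (β : ℝ) (k : ℕ) : ℝ := (cfB β k : ℝ) * β - (cfA β k : ℝ)


lemma gaussIter_props (β : ℝ) (hirr : Irrational β) (h0 : 0 < β) (h1 : β < 1) (k : ℕ) :
    Irrational (gaussIter β k) ∧ 0 < gaussIter β k ∧ gaussIter β k < 1 := by
  induction k with
  | zero => exact ⟨hirr, h0, h1⟩
  | succ k ih =>
    obtain ⟨hi, -, -⟩ := ih
    have hi' : Irrational (gaussIter β (k + 1)) := by
      have : Irrational (1 / gaussIter β k) := by
        rw [one_div]; exact hi.inv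
      exact this.sub_intCast _
    refine ⟨hi', ?_, ?_⟩
    · refine lt_of_le_of_ne ?_ (hi'.ne_zero).symm
      exact Int.fract_nonneg _
    · exact Int.fract_lt_one _

lemma cfD_rec (β : ℝ) (k : ℕ) :
    cfD β (k + 2) = (pq β (k + 2) : ℝ) * cfD β (k + 1) + cfD β k := by
  simp only [cfD, cfB, cfA]; push_cast; ring

lemma cfD_zero (β : ℝ) : cfD β 0 = β := by simp [cfD, cfB, cfA]

lemma cfD_one (β : ℝ) : cfD β 1 = pq β 1 * β - 1 := by simp [cfD, cfB, cfA]

lemma gaussIter_mul (β : ℝ) (hirr : Irrational β) (h0 : 0 < β) (h1 : β < 1) (k : ℕ) :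
    gaussIter β k * gaussIter β (k + 1) = 1 - pq β (k + 1) * gaussIter β k := by
  have h := (gaussIter_props β hirr h0 h1 k).2.1
  simp only [gaussIter, pq, Nat.add_sub_cancel]
  field_simp

lemma cfD_succ (β : ℝ) (hirr : Irrational β) (h0 : 0 < β) (h1 : β < 1) (k : ℕ) :
    cfD β (k + 1) = - gaussIter β (k + 1) * cfD β k := by
  induction k with
  | zero =>
    have h := gaussIter_mul β hirr h0 h1 0
    have e : gaussIter β 0 = β := rfl
    rw [zero_add, cfD_one, cfD_zero]
    rw [e, zero_add] at h
    linarith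
  | succ k ih =>
    have hp := (gaussIter_props β hirr h0 h1 (k + 1)).2.1
    have h := gaussIter_mul β hirr h0 h1 (k + 1)
    have hr := cfD_rec β k
    have e : k + 1 + 1 = k + 2 := rfl
    rw [e] at h ⊢
    rw [hr, ih]
    linear_combination (-cfD β k) * h

/-- the absolute value of `D_k`, written with an explicit sign -/
noncomputable def cfd (β : ℝ) (k : ℕ) : ℝ := (-1) ^ k * cfD β k

lemma cfd_succ (β : ℝ) (hirr : Irrational β) (h0 : 0 < β) (h1 : β < 1) (k : ℕ) :
    cfd β (k + 1) = gaussIter β (k + 1) * cfd β k := by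
  rw [cfd, cfd, cfD_succ β hirr h0 h1, pow_succ]; ring

lemma cfd_pos (β : ℝ) (hirr : Irrational β) (h0 : 0 < β) (h1 : β < 1) (k : ℕ) :
    0 < cfd β k := by
  induction k with
  | zero => simpa [cfd, cfD_zero] using h0
  | succ k ih =>
    rw [cfd_succ β hirr h0 h1]
    exact mul_pos (gaussIter_props β hirr h0 h1 _).2.1 ih

lemma cfd_le (β : ℝ) (hirr : Irrational β) (h0 : 0 < β) (h1 : β < 1) (k : ℕ) :
    cfd β (k + 1) ≤ cfd β k := by
  rw [cfd_succ β hirr h0 h1]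
  have := cfd_pos β hirr h0 h1 k
  have := (gaussIter_props β hirr h0 h1 (k + 1)).2.2
  nlinarith

lemma cfd_rec (β : ℝ) (k : ℕ) :
    cfd β k = (pq β (k + 2) : ℝ) * cfd β (k + 1) + cfd β (k + 2) := by
  simp only [cfd, cfD_rec, pow_succ]; ring

lemma tail_bound (β : ℝ) (hirr : Irrational β) (h0 : 0 < β) (h1 : β < 1) (c : ℕ → ℤ)
    (hcj : ∀ j, 1 ≤ j → 0 ≤ c (j + 1) ∧ c (j + 1) ≤ pq β (j + 1)) (n : ℕ) :
    ∀ k : ℕ, - cfd β (k + 1) ≤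
        (-1) ^ (k + 1) * ∑ j ∈ Finset.range n, (c (j + k + 2) : ℝ) * cfD β (j + k + 1) ∧
      (-1) ^ (k + 1) * ∑ j ∈ Finset.range n, (c (j + k + 2) : ℝ) * cfD β (j + k + 1)
        ≤ cfd β k := by
  induction n with
  | zero =>
    intro k
    have := cfd_pos β hirr h0 h1 k
    have := cfd_pos β hirr h0 h1 (k + 1)
    simp; constructor <;> linarith
  | succ n ih =>
    intro k
    obtain ⟨l, u⟩ := ih (k + 1)
    have e : ∑ j ∈ Finset.range (n + 1), (c (j + k + 2) : ℝ) * cfD β (j + k + 1)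
        = ∑ j ∈ Finset.range n, (c (j + (k + 1) + 2) : ℝ) * cfD β (j + (k + 1) + 1)
          + c (k + 2) * cfD β (k + 1) := by
      rw [Finset.sum_range_succ']
      congr 1
      · refine Finset.sum_congr rfl fun j _ => ?_
        rw [show j + 1 + k = j + (k + 1) by ring]
      · simp
    rw [e]
    set T := ∑ j ∈ Finset.range n, (c (j + (k + 1) + 2) : ℝ) * cfD β (j + (k + 1) + 1)
    have e2 : (-1 : ℝ) ^ (k + 1) * (T + c (k + 2) * cfD β (k + 1))
        = c (k + 2) * cfd β (k + 1) - (-1) ^ (k + 1 + 1) * T := by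
      rw [cfd, pow_succ (-1 : ℝ) (k + 1)]; ring
    rw [e2]
    have hc := hcj (k + 1) (by omega)
    have c0 : (0 : ℝ) ≤ c (k + 2) := by exact_mod_cast hc.1
    have ca : (c (k + 2) : ℝ) ≤ pq β (k + 2) := by exact_mod_cast hc.2
    have dp := cfd_pos β hirr h0 h1 (k + 1)
    have hr := cfd_rec β k
    have m1 := mul_nonneg c0 dp.le
    have m2 := mul_le_mul_of_nonneg_right ca dp.le
    rw [show k + 1 + 1 = k + 2 from rfl] at *
    constructor <;> linarith

lemma abs_cfD (β : ℝ) (hirr : Irrational β) (h0 : 0 < β) (h1 : β < 1) (k : ℕ) :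
    |cfD β k| = cfd β k := by
  rw [← abs_of_pos (cfd_pos β hirr h0 h1 k), cfd, abs_mul]; simp

/-- Let `β ∈ (0,1/2)` be irrational and let `m` have Ostrowski representation
`m = ∑_{j=0}^{p} c_{j+1} B_j` of type `γ(m) = 0` (so `c₁ ≥ 1`). Then
`‖mβ‖ ≥ min((c₁-1)|D₀| + (a₂-c₂)|D₁|, (a₁-c₁)|D₀| + c₂|D₁|)`, and consequently
`‖mβ‖ ≥ min((c₁-1)/(2B₁) + (a₂-c₂)/(2B₂), (a₁-c₁)/(2B₁) + c₂/(2B₂))`. -/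
theorem statement12 (β : ℝ) (hirr : Irrational β) (hβ : β ∈ Set.Ioo (0 : ℝ) (1 / 2))
    (m : ℕ) (hm : 0 < m) (p : ℕ) (c : ℕ → ℤ)
    (hrep : (m : ℤ) = ∑ j ∈ Finset.range (p + 1), c (j + 1) * cfB β j)
    (hc1 : 0 ≤ c 1 ∧ c 1 < pq β 1)
    (hcj : ∀ j, 1 ≤ j → 0 ≤ c (j + 1) ∧ c (j + 1) ≤ pq β (j + 1))
    (hnext : ∀ j, 1 ≤ j → c (j + 1) = pq β (j + 1) → c j = 0)
    (htail : ∀ j, p + 1 < j → c j = 0)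
    (htype0 : c 1 ≠ 0) :
    min (((c 1 : ℝ) - 1) * |cfD β 0| + ((pq β 2 : ℝ) - (c 2 : ℝ)) * |cfD β 1|)
        (((pq β 1 : ℝ) - (c 1 : ℝ)) * |cfD β 0| + (c 2 : ℝ) * |cfD β 1|) ≤
      nearestIntDist (m * β) ∧
    min (((c 1 : ℝ) - 1) / (2 * (cfB β 1 : ℝ)) + ((pq β 2 : ℝ) - (c 2 : ℝ)) / (2 * (cfB β 2 : ℝ)))
        (((pq β 1 : ℝ) - (c 1 : ℝ)) / (2 * (cfB β 1 : ℝ)) + (c 2 : ℝ) / (2 * (cfB β 2 : ℝ))) ≤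
      nearestIntDist (m * β) := by
  obtain ⟨h0, hh⟩ := hβ
  have h1 : β < 1 := by linarith
  rw [abs_cfD β hirr h0 h1, abs_cfD β hirr h0 h1]
  have p0 := cfd_pos β hirr h0 h1 0
  have p1 := cfd_pos β hirr h0 h1 1
  have l1 := cfd_le β hirr h0 h1 0
  have l2 := cfd_le β hirr h0 h1 1
  have r0 := cfd_rec β 0
  have d0 : cfd β 0 = β := by simp [cfd, cfD_zero]
  have d1 : cfd β 1 = 1 - pq β 1 * β := by simp [cfd, cfD_one]
  obtain ⟨tl, tu⟩ := tail_bound β hirr h0 h1 c hcj p 1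
  norm_num at l1 l2 r0 tl tu
  -- the expansion of `m β` modulo integers
  obtain ⟨N, hN⟩ : ∃ N : ℤ, (m : ℝ) * β - N = c 1 * cfd β 0 - c 2 * cfd β 1 +
      ∑ j ∈ Finset.range p, (c (j + 1 + 2) : ℝ) * cfD β (j + 1 + 1) := by
    refine ⟨∑ j ∈ Finset.range (p + 1), c (j + 1) * cfA β j, ?_⟩
    have hm' : (m : ℝ) = ∑ j ∈ Finset.range (p + 1), (c (j + 1) : ℝ) * cfB β j := by
      exact_mod_cast hrep
    have e1 : (m : ℝ) * β - ((∑ j ∈ Finset.range (p + 1), c (j + 1) * cfA β j : ℤ) : ℝ)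
        = ∑ j ∈ Finset.range (p + 1), (c (j + 1) : ℝ) * cfD β j := by
      rw [hm']; push_cast
      rw [Finset.sum_mul, ← Finset.sum_sub_distrib]
      refine Finset.sum_congr rfl fun j _ => ?_
      rw [cfD]; ring
    have e2 : ∑ j ∈ Finset.range (p + 1), (c (j + 1) : ℝ) * cfD β j
        = ∑ j ∈ Finset.range (p + 2), (c (j + 1) : ℝ) * cfD β j := by
      rw [Finset.sum_range_succ _ (p + 1), htail (p + 1 + 1) (by omega)]; simp
    rw [e1, e2, Finset.sum_range_succ', Finset.sum_range_succ']
    simp only [cfd]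
    norm_num
    ring
  norm_num at hN
  set T := ∑ j ∈ Finset.range p, (c (j + 1 + 2) : ℝ) * cfD β (j + 1 + 1)
  have hc2 := hcj 1 le_rfl
  norm_num at hc2
  have c1 : (1 : ℝ) ≤ c 1 := by
    have : 1 ≤ c 1 := by have := hc1.1; omega
    exact_mod_cast this
  have ca1 : (c 1 : ℝ) ≤ pq β 1 := by exact_mod_cast hc1.2.le
  have c20 : (0 : ℝ) ≤ c 2 := by exact_mod_cast hc2.1
  have ca2 : (c 2 : ℝ) ≤ pq β 2 := by exact_mod_cast hc2.2
  have main : min (((c 1 : ℝ) - 1) * cfd β 0 + ((pq β 2 : ℝ) - (c 2 : ℝ)) * cfd β 1)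
        (((pq β 1 : ℝ) - (c 1 : ℝ)) * cfd β 0 + (c 2 : ℝ) * cfd β 1) ≤
      nearestIntDist (m * β) := by
    rw [nearestIntDist, min_le_iff]
    rcases le_or_gt (round ((m : ℝ) * β)) N with h | h
    · left
      have h' : ((round ((m : ℝ) * β) : ℤ) : ℝ) ≤ N := by exact_mod_cast h
      refine le_trans ?_ (le_abs_self _)
      linarith
    · right
      have h' : (N : ℝ) + 1 ≤ ((round ((m : ℝ) * β) : ℤ) : ℝ) := by exact_mod_cast h
      refine le_trans ?_ (neg_le_abs _)
      rw [d0] at *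
      linarith
  refine ⟨main, le_trans (min_le_min ?_ ?_) main⟩
  all_goals
    have b1 : (cfB β 1 : ℝ) = pq β 1 := by simp [cfB]
    have b2 : (cfB β 2 : ℝ) = pq β 2 * pq β 1 + 1 := by simp [cfB]
    have a1 : (1 : ℝ) ≤ pq β 1 := by linarith
    have a2 : (1 : ℝ) ≤ pq β 2 := by
      have : (1 : ℤ) ≤ pq β 2 := by
        rw [pq, Int.le_floor]
        have := gaussIter_props β hirr h0 h1 (2 - 1)
        rw [le_div_iff₀ this.2.1]
        push_cast
        linarith [this.2.2]
      exact_mod_cast this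
    have q1 : 1 / (2 * (cfB β 1 : ℝ)) ≤ cfd β 0 := by
      rw [b1, div_le_iff₀ (by positivity)]
      nlinarith
    have q2 : 1 / (2 * (cfB β 2 : ℝ)) ≤ cfd β 1 := by
      rw [b2, div_le_iff₀ (by positivity)]
      have k1 : (pq β 2 * pq β 1 + 1) * cfd β 1 + pq β 1 * cfd β 2 = 1 := by
        linear_combination d1 + pq β 1 * d0 - pq β 1 * r0
      have k2 : (pq β 1 : ℝ) * cfd β 2 ≤ pq β 1 * cfd β 1 :=
        mul_le_mul_of_nonneg_left l2 (by linarith)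
      have k3 : (pq β 1 : ℝ) * cfd β 1 ≤ pq β 2 * pq β 1 * cfd β 1 :=
        mul_le_mul_of_nonneg_right (by nlinarith) p1.le
      linarith
    rw [div_eq_mul_one_div _ (2 * (cfB β 1 : ℝ)), div_eq_mul_one_div _ (2 * (cfB β 2 : ℝ))]
    refine add_le_add (mul_le_mul_of_nonneg_left q1 (by linarith))
      (mul_le_mul_of_nonneg_left q2 (by linarith))
end

section
/- Let β ∈ (0,1) be irrational with continued fraction denominators B_k, let n be a positive integer, and for an index l ≥ 0 and an integer c with 1 ≤ c ≤ a_{l+1}, let A_{l,c} = { m ∈ {1,…,n} : the Ostrowski representation of m has type γ(m) = l and leading coefficient c_{l+1}(m) = c }. Then any two distinct elements of A_{l,c} differ by at least B_{l+1}; consequently #A_{l,c} ≤ ⌊n / B_{l+1}⌋ + 1. In particular, if l is the maximal type occurring among {1,…,n} (so that B_{l+1} > n), then #A_{l,c} ≤ 1. -/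
/-- `c : ℕ → ℤ` (with `c 1, c 2, …` the coefficients, zero beyond index `p+1`) is the
Ostrowski representation `m = ∑_{j=0}^{p} c_{j+1} B_j` of `m` with respect to `β`. -/
def OstRepCoeffs (β : ℝ) (m : ℕ) (p : ℕ) (c : ℕ → ℤ) : Prop :=
  ((m : ℤ) = ∑ j ∈ Finset.range (p + 1), c (j + 1) * cfB β j) ∧
  (0 ≤ c 1 ∧ c 1 < pq β 1) ∧
  (∀ j, 1 ≤ j → 0 ≤ c (j + 1) ∧ c (j + 1) ≤ pq β (j + 1)) ∧
  (∀ j, 1 ≤ j → c (j + 1) = pq β (j + 1) → c j = 0) ∧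
  (∀ j, p + 1 < j → c j = 0)

theorem gaussIter_spec (β : ℝ) (hirr : Irrational β) (hβ : β ∈ Set.Ioo (0 : ℝ) 1) (k : ℕ) :
    Irrational (gaussIter β k) ∧ 0 < gaussIter β k ∧ gaussIter β k < 1 := by
  induction k with
  | zero => exact ⟨hirr, hβ.1, hβ.2⟩
  | succ k ih =>
    obtain ⟨h1, h2, h3⟩ := ih
    have hi : Irrational (gaussIter β (k + 1)) := by
      rw [gaussIter, one_div]
      exact (h1.inv).sub_intCast _
    refine ⟨hi, ?_, ?_⟩
    · refine lt_of_le_of_ne ?_ (Ne.symm hi.ne_zero)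
      rw [gaussIter]
      linarith [Int.floor_le (1 / gaussIter β k)]
    · rw [gaussIter]
      linarith [Int.lt_floor_add_one (1 / gaussIter β k)]

theorem pq_pos (β : ℝ) (hirr : Irrational β) (hβ : β ∈ Set.Ioo (0 : ℝ) 1) (k : ℕ) :
    1 ≤ pq β k := by
  obtain ⟨-, h2, h3⟩ := gaussIter_spec β hirr hβ (k - 1)
  rw [pq, Int.le_floor]
  push_cast
  exact (one_le_div h2).2 h3.le

theorem cfB_pos (β : ℝ) (hirr : Irrational β) (hβ : β ∈ Set.Ioo (0 : ℝ) 1) (k : ℕ) :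
    1 ≤ cfB β k ∧ 1 ≤ cfB β (k + 1) := by
  induction k with
  | zero => exact ⟨by simp [cfB], by simpa [cfB] using pq_pos β hirr hβ 1⟩
  | succ k ih =>
    refine ⟨ih.2, ?_⟩
    have h : cfB β (k + 1 + 1) = pq β (k + 2) * cfB β (k + 1) + cfB β k := by simp [cfB]
    rw [h]
    nlinarith [pq_pos β hirr hβ (k + 2), ih.1, ih.2]

/-- partial sums -/
noncomputable def ostT (β : ℝ) (c : ℕ → ℤ) (k : ℕ) : ℤ :=
  ∑ j ∈ Finset.range k, c (j + 1) * cfB β j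

theorem ostT_succ (β : ℝ) (c : ℕ → ℤ) (k : ℕ) :
    ostT β c (k + 1) = ostT β c k + c (k + 1) * cfB β k := Finset.sum_range_succ _ _

theorem ostT_base (β : ℝ) (cc : ℕ → ℤ) (l : ℕ) (h : ∀ j, j < l → cc (j + 1) = 0) :
    ostT β cc (l + 1) = cc (l + 1) * cfB β l := by
  rw [ostT_succ]
  have : ostT β cc l = 0 := by
    apply Finset.sum_eq_zero
    intro j hj
    rw [h j (Finset.mem_range.1 hj), zero_mul]
  rw [this, zero_add]

theorem ostT_eventually (β : ℝ) (m p : ℕ) (cc : ℕ → ℤ) (h : OstRepCoeffs β m p cc) (k : ℕ) :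
    ostT β cc (p + 1 + k) = m := by
  induction k with
  | zero => exact h.1.symm
  | succ k ih =>
    rw [← add_assoc, ostT_succ, ih, h.2.2.2.2 _ (by omega)]
    simp

theorem ostT_lower (β : ℝ) (hirr : Irrational β) (hβ : β ∈ Set.Ioo (0 : ℝ) 1)
    (m p : ℕ) (cc : ℕ → ℤ) (h : OstRepCoeffs β m p cc) (l : ℕ)
    (h0 : ∀ j, j < l → cc (j + 1) = 0) (k : ℕ) :
    cc (l + 1) * cfB β l ≤ ostT β cc (l + 1 + k) := by
  induction k with
  | zero => exact (ostT_base β cc l h0).ge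
  | succ k ih =>
    rw [← add_assoc, ostT_succ]
    have h1 := (h.2.2.1 (l + 1 + k) (by omega)).1
    have h2 := (cfB_pos β hirr hβ (l + 1 + k)).1
    have := mul_nonneg h1 (by linarith : (0:ℤ) ≤ cfB β (l + 1 + k))
    linarith

theorem ostT_upper (β : ℝ) (hirr : Irrational β) (hβ : β ∈ Set.Ioo (0 : ℝ) 1)
    (m p : ℕ) (cc : ℕ → ℤ) (h : OstRepCoeffs β m p cc) (l : ℕ)
    (h0 : ∀ j, j < l → cc (j + 1) = 0) (h1 : 1 ≤ cc (l + 1)) (k : ℕ) :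
    ostT β cc (l + 1 + k) ≤ cfB β (l + 1 + k) - cfB β (l + 1) + cc (l + 1) * cfB β l ∧
    ostT β cc (l + 1 + (k + 1)) ≤
      cfB β (l + 1 + (k + 1)) - cfB β (l + 1) + cc (l + 1) * cfB β l := by
  have hstep : ∀ j, cfB β (j + 2) = pq β (j + 2) * cfB β (j + 1) + cfB β j := by
    intro j; simp [cfB]
  induction k with
  | zero =>
    have hb := ostT_base β cc l h0
    refine ⟨by simp [hb], ?_⟩
    have hlt : cc (l + 1 + 1) ≤ pq β (l + 1 + 1) - 1 := by
      have h2 := (h.2.2.1 (l + 1) (by omega)).2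
      have h3 := h.2.2.2.1 (l + 1) (by omega)
      by_contra hcon
      have := h3 (by omega)
      omega
    have e : l + 1 + (0 + 1) = l + 2 := by omega
    rw [e, hstep, show l + 2 = l + 1 + 1 from rfl, ostT_succ, hb]
    have p1 := (cfB_pos β hirr hβ l).1
    have p2 := (cfB_pos β hirr hβ l).2
    nlinarith [mul_le_mul_of_nonneg_right hlt (by linarith : (0:ℤ) ≤ cfB β (l + 1))]
  | succ k ih =>
    refine ⟨ih.2, ?_⟩
    obtain ⟨i1, i2⟩ := ih
    have e : l + 1 + (k + 1 + 1) = (l + 1 + k) + 2 := by omega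
    have e1 : l + 1 + (k + 1) = (l + 1 + k) + 1 := by omega
    rw [e1] at i2
    rw [e]
    generalize hq : l + 1 + k = q at *
    rw [hstep, show q + 2 = q + 1 + 1 from rfl, ostT_succ]
    have p1 := (cfB_pos β hirr hβ q).1
    have p2 := (cfB_pos β hirr hβ q).2
    have hle := (h.2.2.1 (q + 1) (by omega)).2
    have h3 := h.2.2.2.1 (q + 1) (by omega)
    rcases hle.eq_or_lt with he | hlt
    · have hz := h3 he
      rw [ostT_succ, hz, he]
      linarith
    · have hlt' : cc (q + 1 + 1) ≤ pq β (q + 1 + 1) - 1 := by omega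
      nlinarith [mul_le_mul_of_nonneg_right hlt' (by linarith : (0:ℤ) ≤ cfB β (q + 1))]

theorem ostT_sep (β : ℝ) (hirr : Irrational β) (hβ : β ∈ Set.Ioo (0 : ℝ) 1)
    (m p m' p' : ℕ) (cc cc' : ℕ → ℤ) (h : OstRepCoeffs β m p cc) (h' : OstRepCoeffs β m' p' cc')
    (l : ℕ) (c : ℤ) (hc : 1 ≤ c)
    (h0 : ∀ j, j < l → cc (j + 1) = 0) (h1 : cc (l + 1) = c)
    (h0' : ∀ j, j < l → cc' (j + 1) = 0) (h1' : cc' (l + 1) = c) (k : ℕ) :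
    ostT β cc (l + 1 + k) = ostT β cc' (l + 1 + k) ∨
    cfB β (l + 1) ≤ |ostT β cc (l + 1 + k) - ostT β cc' (l + 1 + k)| := by
  induction k with
  | zero =>
    left
    simp only [add_zero]
    rw [ostT_base β cc l h0, ostT_base β cc' l h0', h1, h1']
  | succ k ih =>
    have l1 := ostT_lower β hirr hβ m p cc h l h0 k
    have l2 := ostT_lower β hirr hβ m' p' cc' h' l h0' k
    have u1 := (ostT_upper β hirr hβ m p cc h l h0 (by omega) k).1
    have u2 := (ostT_upper β hirr hβ m' p' cc' h' l h0' (by omega) k).1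
    rw [h1] at l1 u1
    rw [h1'] at l2 u2
    have p1 := (cfB_pos β hirr hβ (l + 1 + k)).1
    rw [← add_assoc, ostT_succ, ostT_succ]
    generalize l + 1 + k = q at *
    rcases lt_trichotomy (cc (q + 1)) (cc' (q + 1)) with hl | he | hg
    · right
      rw [abs_sub_comm]
      refine le_trans ?_ (le_abs_self _)
      have : cc (q + 1) + 1 ≤ cc' (q + 1) := by omega
      nlinarith [mul_le_mul_of_nonneg_right this (by linarith : (0:ℤ) ≤ cfB β q)]
    · rw [he]
      simpa using ih
    · right
      refine le_trans ?_ (le_abs_self _)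
      have : cc' (q + 1) + 1 ≤ cc (q + 1) := by omega
      nlinarith [mul_le_mul_of_nonneg_right this (by linarith : (0:ℤ) ≤ cfB β q)]

/-- For irrational `β ∈ (0,1)`, `n ≥ 1`, an index `l` and `1 ≤ c ≤ a_{l+1}`,
let `A_{l,c}` be the set of `m ∈ {1,…,n}` whose Ostrowski representation has type `l` and
leading coefficient `c_{l+1}(m) = c`. Then any two distinct elements of `A_{l,c}` differ by at
least `B_{l+1}`; consequently `#A_{l,c} ≤ ⌊n/B_{l+1}⌋ + 1`, and if `B_{l+1} > n` (as happens
when `l` is the maximal type occurring in `{1,…,n}`) then `#A_{l,c} ≤ 1`. -/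
theorem statement13 (β : ℝ) (hirr : Irrational β) (hβ : β ∈ Set.Ioo (0 : ℝ) 1)
    (n : ℕ) (hn : 0 < n) (l : ℕ) (c : ℤ) (hc1 : 1 ≤ c) (hc2 : c ≤ pq β (l + 1)) :
    ∀ A : Set ℕ,
      A = {m : ℕ | 1 ≤ m ∧ m ≤ n ∧ ∃ (p : ℕ) (cc : ℕ → ℤ), OstRepCoeffs β m p cc ∧
            (∀ j, j < l → cc (j + 1) = 0) ∧ cc (l + 1) = c} →
      (∀ m₁ ∈ A, ∀ m₂ ∈ A, m₁ ≠ m₂ → cfB β (l + 1) ≤ |(m₁ : ℤ) - (m₂ : ℤ)|) ∧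
      A.Finite ∧
      (A.ncard : ℤ) ≤ (n : ℤ) / cfB β (l + 1) + 1 ∧
      ((n : ℤ) < cfB β (l + 1) → A.ncard ≤ 1) := by
  intro A hA
  have hsep : ∀ m₁ ∈ A, ∀ m₂ ∈ A, m₁ ≠ m₂ → cfB β (l + 1) ≤ |(m₁ : ℤ) - (m₂ : ℤ)| := by
    intro m₁ hm₁ m₂ hm₂ hne
    rw [hA] at hm₁ hm₂
    obtain ⟨-, -, p, cc, h, h0, h1⟩ := hm₁
    obtain ⟨-, -, p', cc', h', h0', h1'⟩ := hm₂
    have key := ostT_sep β hirr hβ m₁ p m₂ p' cc cc' h h' l c hc1 h0 h1 h0' h1' (p + p' + 1)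
    have e1 := ostT_eventually β m₁ p cc h (l + 1 + p')
    have e2 := ostT_eventually β m₂ p' cc' h' (l + 1 + p)
    rw [show p + 1 + (l + 1 + p') = l + 1 + (p + p' + 1) by omega] at e1
    rw [show p' + 1 + (l + 1 + p) = l + 1 + (p + p' + 1) by omega] at e2
    rw [e1, e2] at key
    rcases key with k | k
    · exact absurd (by exact_mod_cast k) hne
    · exact k
  have hB : 1 ≤ cfB β (l + 1) := (cfB_pos β hirr hβ l).2
  have hle : ∀ m ∈ A, m ≤ n := by
    intro m hm
    rw [hA] at hm
    exact hm.2.1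
  have hfin : A.Finite := (Set.finite_Iic n).subset hle
  obtain ⟨b, hb⟩ : ∃ b : ℕ, cfB β (l + 1) = b := ⟨(cfB β (l + 1)).toNat, by omega⟩
  have hb1 : 1 ≤ b := by omega
  have hcard : A.ncard ≤ n / b + 1 := by
    have := Set.ncard_le_ncard_of_injOn (s := A) (t := Set.Iio (n / b + 1)) (fun m => m / b)
      (fun m hm => Nat.lt_succ_of_le (Nat.div_le_div_right (hle m hm)))
      (by
        intro x hx y hy hxy
        by_contra hne
        have hs := hsep x hx y hy hne
        rw [hb] at hs
        simp only at hxy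
        have ex := Nat.div_add_mod x b
        have ey := Nat.div_add_mod y b
        have mx := Nat.mod_lt x hb1
        have my := Nat.mod_lt y hb1
        rw [hxy] at ex
        rcases le_abs.1 hs with h | h <;> omega)
      (Set.finite_Iio _)
    simpa [Set.ncard_eq_toFinset_card'] using this
  refine ⟨hsep, hfin, ?_, ?_⟩
  · rw [hb]
    exact_mod_cast hcard
  · intro hlt
    rw [hb] at hlt
    rw [Nat.div_eq_of_lt (by exact_mod_cast hlt)] at hcard
    exact hcard
end
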